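/- Let A ∈ ℝ^{m×n}, let X ∈ ℝ^{n×p} have full row rank n, let X Xᵀ = P Λ Pᵀ be a spectral decomposition with P orthogonal and Λ diagonal with positive diagonal entries, and let γ > 0. Let γ·(A P) = Σ_{i=1}^r σ̂_i û_i v̂_iᵀ be an SVD with r = rank(A). For 1 ≤ k ≤ r define Ã_k = (1/γ)·(Σ_{i=1}^k σ̂_i û_i v̂_iᵀ)·Pᵀ. Then the squared compression loss satisfies ‖(A − Ã_k) X‖_F² = Σ_{i=k+1}^r (σ̂_i²/γ²)·(v̂_iᵀ Λ v̂_i). -/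

import Mathlib

open Matrix Finset

/-- Frobenius norm of a real matrix. -/
noncomputable def frob {m n : ℕ} (M : Matrix (Fin m) (Fin n) ℝ) : ℝ :=
  Real.sqrt (∑ i, ∑ j, (M i j) ^ 2)

/-- The squared Frobenius norm is the trace of `M Mᵀ`. -/
lemma frob_sq_eq_trace {m n : ℕ} (M : Matrix (Fin m) (Fin n) ℝ) :
    frob M ^ 2 = (M * Mᵀ).trace := by
  rw [frob, Real.sq_sqrt (by positivity)]
  simp [Matrix.trace, Matrix.mul_apply, sq]

/-- Pythagoras for a combination of finitely many orthonormal vectors. -/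
lemma sum_sq_sum_mul_of_orthonormal {ι κ : Type*} [Fintype κ] [DecidableEq ι]
    (s : Finset ι) (u : ι → κ → ℝ)
    (hu : ∀ i j, (∑ x, u i x * u j x) = if i = j then (1 : ℝ) else 0) (c : ι → ℝ) :
    ∑ x, (∑ i ∈ s, c i * u i x) ^ 2 = ∑ i ∈ s, c i ^ 2 := by
  calc ∑ x, (∑ i ∈ s, c i * u i x) ^ 2
      = ∑ x, ∑ i ∈ s, ∑ j ∈ s, c i * c j * (u i x * u j x) := by
        refine Finset.sum_congr rfl fun x _ => ?_
        rw [sq, Finset.sum_mul_sum]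
        refine Finset.sum_congr rfl fun i _ => Finset.sum_congr rfl fun j _ => ?_
        ring
    _ = ∑ i ∈ s, ∑ j ∈ s, c i * c j * ∑ x, u i x * u j x := by
        rw [Finset.sum_comm]
        refine Finset.sum_congr rfl fun i _ => ?_
        rw [Finset.sum_comm]
        simp only [Finset.mul_sum]
    _ = ∑ i ∈ s, c i ^ 2 := by
        refine Finset.sum_congr rfl fun i hi => ?_
        simp [hu, hi, sq]

/-- The `diagonal d`-weighted squared norm of a sum of rank-one matrices with orthonormal left
factors. -/
lemma trace_sum_vecMulVec_mul_diagonal {ι : Type*} {m n : ℕ} [DecidableEq ι] (s : Finset ι)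
    (σ : ι → ℝ) (u : ι → Fin m → ℝ) (v : ι → Fin n → ℝ) (d : Fin n → ℝ)
    (hu : ∀ i j, (∑ x, u i x * u j x) = if i = j then (1 : ℝ) else 0) :
    ((∑ i ∈ s, σ i • vecMulVec (u i) (v i)) * Matrix.diagonal d *
      (∑ i ∈ s, σ i • vecMulVec (u i) (v i))ᵀ).trace =
      ∑ i ∈ s, σ i ^ 2 * ∑ a, d a * v i a ^ 2 := by
  set T := ∑ i ∈ s, σ i • vecMulVec (u i) (v i) with hT
  have entry (x a) : T x a = ∑ i ∈ s, σ i * v i a * u i x := by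
    rw [hT, Matrix.sum_apply]
    refine Finset.sum_congr rfl fun i _ => ?_
    simp only [Matrix.smul_apply, vecMulVec_apply, smul_eq_mul]
    ring
  calc (T * Matrix.diagonal d * Tᵀ).trace = ∑ x, ∑ a, d a * T x a ^ 2 := by
        refine Finset.sum_congr rfl fun x _ => ?_
        rw [Matrix.diag_apply, Matrix.mul_apply]
        refine Finset.sum_congr rfl fun a _ => ?_
        rw [Matrix.mul_diagonal, Matrix.transpose_apply]
        ring
    _ = ∑ a, d a * ∑ i ∈ s, (σ i * v i a) ^ 2 := by
        rw [Finset.sum_comm]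
        refine Finset.sum_congr rfl fun a _ => ?_
        simp only [← Finset.mul_sum, entry]
        rw [sum_sq_sum_mul_of_orthonormal s u hu]
    _ = ∑ i ∈ s, σ i ^ 2 * ∑ a, d a * v i a ^ 2 := by
        simp only [Finset.mul_sum]
        rw [Finset.sum_comm]
        refine Finset.sum_congr rfl fun i _ => Finset.sum_congr rfl fun a _ => ?_
        ring

/-- ASVD-III, rank-`k` truncation: with `X Xᵀ = P Λ Pᵀ` and an SVD of `γ·(A P)`, truncating the
trailing singular values gives squared loss `Σ_{i>k} (σ̂_i²/γ²)·(v̂_iᵀ Λ v̂_i)`. -/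
theorem asvd_scaled_eigen_truncation_sq_loss
    (m n p r k : ℕ) (A : Matrix (Fin m) (Fin n) ℝ)
    (X : Matrix (Fin n) (Fin p) ℝ) (hX : X.rank = n)
    (P : Matrix (Fin n) (Fin n) ℝ) (d : Fin n → ℝ)
    (hP : Pᵀ * P = 1) (hd : ∀ i, 0 < d i)
    (hspec : X * Xᵀ = P * Matrix.diagonal d * Pᵀ)
    (γ : ℝ) (hγ : 0 < γ)
    (σ : Fin r → ℝ) (u : Fin r → Fin m → ℝ) (v : Fin r → Fin n → ℝ)
    (hr : A.rank = r)
    (hσpos : ∀ i, 0 < σ i)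
    (hσanti : ∀ i j : Fin r, i ≤ j → σ j ≤ σ i)
    (hu : ∀ i j : Fin r, (∑ x, u i x * u j x) = if i = j then (1 : ℝ) else 0)
    (hv : ∀ i j : Fin r, (∑ x, v i x * v j x) = if i = j then (1 : ℝ) else 0)
    (hsvd : γ • (A * P) = ∑ i : Fin r, σ i • vecMulVec (u i) (v i))
    (hk1 : 1 ≤ k) (hkr : k ≤ r)
    (Ak : Matrix (Fin m) (Fin n) ℝ)
    (hAk : Ak = γ⁻¹ • ((∑ i ∈ Finset.univ.filter (fun i : Fin r => (i : ℕ) < k),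
        σ i • vecMulVec (u i) (v i)) * Pᵀ)) :
    frob ((A - Ak) * X) ^ 2 =
      ∑ i ∈ Finset.univ.filter (fun i : Fin r => k ≤ (i : ℕ)),
        (σ i ^ 2 / γ ^ 2) * (∑ a, d a * (v i a) ^ 2) := by
  set T := ∑ i ∈ Finset.univ.filter (fun i : Fin r => k ≤ (i : ℕ)),
    σ i • vecMulVec (u i) (v i) with hT
  have hdiff : A - Ak = γ⁻¹ • (T * Pᵀ) := by
    have hA : A = γ⁻¹ • ((γ • (A * P)) * Pᵀ) := by
      rw [Matrix.smul_mul, Matrix.mul_assoc, mul_eq_one_comm.mp hP, Matrix.mul_one,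
        inv_smul_smul₀ hγ.ne']
    have hsplit := Finset.sum_filter_add_sum_filter_not Finset.univ
      (fun i : Fin r => (i : ℕ) < k) (fun i => σ i • vecMulVec (u i) (v i))
    simp only [not_lt] at hsplit
    rw [hsvd, ← hsplit, ← hT] at hA
    rw [hAk]
    nth_rewrite 1 [hA]
    rw [← smul_sub, ← Matrix.sub_mul, add_sub_cancel_left]
  have hgram : (A - Ak) * X * ((A - Ak) * X)ᵀ =
      (γ⁻¹ * γ⁻¹) • (T * Matrix.diagonal d * Tᵀ) := by
    calc (A - Ak) * X * ((A - Ak) * X)ᵀ = (A - Ak) * (X * Xᵀ) * (A - Ak)ᵀ := by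
          simp only [Matrix.transpose_mul, Matrix.mul_assoc]
      _ = (γ⁻¹ * γ⁻¹) • (T * (Pᵀ * P) * Matrix.diagonal d * (Pᵀ * P) * Tᵀ) := by
          rw [hspec, hdiff]
          simp only [Matrix.transpose_smul, Matrix.transpose_mul, Matrix.transpose_transpose,
            Matrix.smul_mul, Matrix.mul_smul, smul_smul, Matrix.mul_assoc]
      _ = (γ⁻¹ * γ⁻¹) • (T * Matrix.diagonal d * Tᵀ) := by
          simp only [hP, Matrix.mul_one]
  rw [frob_sq_eq_trace, hgram, Matrix.trace_smul, hT,
    trace_sum_vecMulVec_mul_diagonal _ σ u v d hu, smul_eq_mul, Finset.mul_sum]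
  refine Finset.sum_congr rfl fun i _ => ?_
  field_simp
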